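/- Let s and r be coprime positive integers, let n ≥ 0 be an integer, let u, v ∈ {0,1}, let a_0, …, a_n ∈ ℂ, and set u_k = u + (n−k)r and v_k = v + ks for 0 ≤ k ≤ n. Let P ∈ ℂ⟨x,y⟩ be quasihomogeneous (for the weights deg x = s, deg y = r) with P_ab = Σ_{k=0}^{n} a_k x^{u_k} y^{v_k}. Then in B_2(ℂ⟨x,y⟩/⟨P⟩): (1) for all integers i ≥ 0 and j ≥ 1, Σ_{k=0}^{n} (a_k/(j + v_k)) · [x^{i+u_k}, y^{j+v_k}] = 0, and (2) for all integers i ≥ 1 and j ≥ 0, Σ_{k=0}^{n} (a_k/(i + u_k)) · [x^{i+u_k}, y^{j+v_k}] = 0, where x and y denote the images of the generators in ℂ⟨x,y⟩/⟨P⟩ and the brackets denote classes in B_2. -/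

import Mathlib

noncomputable section

/-- The free associative unital ℂ-algebra on two generators x, y. -/
abbrev F2 : Type := FreeAlgebra ℂ (Fin 2)

/-- The abelianization homomorphism ℂ⟨x,y⟩ → ℂ[x,y], x ↦ x, y ↦ y. -/
def abmap : F2 →ₐ[ℂ] MvPolynomial (Fin 2) ℂ :=
  FreeAlgebra.lift ℂ (fun i => MvPolynomial.X i)

/-- The relation P = 0; `RingQuot (Prel P)` is the quotient of ℂ⟨x,y⟩ by the
two-sided ideal generated by P. -/
def Prel (P : F2) : F2 → F2 → Prop := fun a b => a = P ∧ b = 0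

/-- The quotient algebra ℂ⟨x,y⟩/⟨P⟩. -/
abbrev AlgQ (P : F2) : Type := RingQuot (Prel P)

/-- The quotient map ℂ⟨x,y⟩ → ℂ⟨x,y⟩/⟨P⟩. -/
def qmap (P : F2) : F2 →ₐ[ℂ] AlgQ P := RingQuot.mkAlgHom ℂ (Prel P)

/-- Lower central series: `lcs A i` is `L_{i+1}(A)`, so `lcs A 0 = L₁(A) = A`,
and `L_{i+2}(A)` is the ℂ-linear span of all `[a,u] = a*u - u*a` with `u ∈ L_{i+1}(A)`. -/
def lcs (A : Type) [Ring A] [Algebra ℂ A] : ℕ → Submodule ℂ A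
  | 0 => ⊤
  | n + 1 => Submodule.span ℂ {x | ∃ a u, u ∈ lcs A n ∧ x = a * u - u * a}

/-- L₃(A) viewed as a submodule of L₂(A). -/
def L3sub (A : Type) [Ring A] [Algebra ℂ A] : Submodule ℂ ↥(lcs A 1) :=
  (lcs A 2).comap (lcs A 1).subtype

/-- B₂(A) = L₂(A)/L₃(A). -/
abbrev B2 (A : Type) [Ring A] [Algebra ℂ A] : Type := ↥(lcs A 1) ⧸ L3sub A

/-- The weight of a word in x,y, where x has weight s and y has weight r. -/
def wordWt (s r : ℕ) (w : List (Fin 2)) : ℕ :=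
  (w.map (fun i => if i = 0 then s else r)).sum

/-- The degree-m homogeneous component of ℂ⟨x,y⟩ for the weighted grading
(deg x = s, deg y = r): the span of the monomials of weight m. -/
def degSub (s r m : ℕ) : Submodule ℂ F2 :=
  Submodule.span ℂ {P | ∃ w : List (Fin 2), wordWt s r w = m ∧ P = (w.map (FreeAlgebra.ι ℂ)).prod}
section LowerCentralSeries

variable {A : Type} [Ring A] [Algebra ℂ A]

theorem commutator_mem_lcs_one (a b : A) : a * b - b * a ∈ lcs A 1 :=
  Submodule.subset_span ⟨a, b, Submodule.mem_top, rfl⟩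

theorem double_commutator_mem_lcs_two (a b c : A) :
    a * (b * c - c * b) - (b * c - c * b) * a ∈ lcs A 2 :=
  Submodule.subset_span ⟨a, _, commutator_mem_lcs_one b c, rfl⟩

theorem map_mem_lcs {B : Type} [Ring B] [Algebra ℂ B] (f : A →ₐ[ℂ] B) (n : ℕ) {a : A}
    (ha : a ∈ lcs A n) : f a ∈ lcs B n := by
  induction n generalizing a with
  | zero => exact Submodule.mem_top
  | succ n ih =>
    have hle : lcs A (n + 1) ≤ (lcs B (n + 1)).comap f.toLinearMap := by
      refine Submodule.span_le.2 ?_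
      rintro _ ⟨c, d, hd, rfl⟩
      exact Submodule.subset_span ⟨f c, f d, ih hd, by simp⟩
    exact hle ha

/-- Commuting with `y` sends the two-sided ideal generated by `[x, y]` into `L₃`. -/
theorem commutator_ideal_mem_lcs_two (w w' x y : A) :
    w * (x * y - y * x) * w' * y - y * (w * (x * y - y * x) * w') ∈ lcs A 2 := by
  have h1 := double_commutator_mem_lcs_two y (w * (x * y - y * x)) w'
  have h2 := double_commutator_mem_lcs_two y (w' * w * x) y
  have h3 := double_commutator_mem_lcs_two (x * y) (w' * w) y
  have h4 := double_commutator_mem_lcs_two x (y * (w' * w)) y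
  convert sub_mem (sub_mem (sub_mem h3 h4) h1) h2 using 1
  noncomm_ring

theorem commutator_pow_sub_mem_lcs_two (a y : A) (n : ℕ) :
    (a * y ^ (n + 1) - y ^ (n + 1) * a) - ((n : ℂ) + 1) • (a * y ^ n * y - y * (a * y ^ n))
      ∈ lcs A 2 := by
  induction n generalizing a with
  | zero => simp
  | succ n ih =>
    have h1 := ih (a * y)
    have h2 := double_commutator_mem_lcs_two y (y ^ (n + 1)) a
    convert sub_mem h1 h2 using 1
    have e : a * y * y ^ n = a * y ^ (n + 1) := by rw [pow_succ', mul_assoc]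
    have e' : y * y ^ (n + 1) = y ^ (n + 1) * y := (pow_mul_comm' y (n + 1)).symm
    rw [e, pow_succ y (n + 1)]
    push_cast
    rw [add_smul ((n : ℂ) + 1), one_smul]
    have e2 : a * y * y ^ (n + 1) = a * y ^ (n + 1) * y := by
      rw [mul_assoc, e', mul_assoc]
    rw [e2]
    have e3 : y * (y ^ (n + 1) * a) = y ^ (n + 1) * y * a := by rw [← mul_assoc, e']
    simp only [mul_sub, sub_mul, e3, ← mul_assoc]
    abel

theorem smul_commutator_pow_sub_mem_lcs_two (a y : A) (n : ℕ) (c : ℂ) :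
    (c / ((n : ℂ) + 1)) • (a * y ^ (n + 1) - y ^ (n + 1) * a)
      - c • (a * y ^ n * y - y * (a * y ^ n)) ∈ lcs A 2 := by
  have hn : (n : ℂ) + 1 ≠ 0 := Nat.cast_add_one_ne_zero n
  convert Submodule.smul_mem _ (c / ((n : ℂ) + 1)) (commutator_pow_sub_mem_lcs_two a y n) using 1
  rw [smul_sub _ (_ - _) (_ • _), smul_smul, div_mul_cancel₀ _ hn]

/-- The congruence `a ~ b` expressing that `[w (a - b) w', c] ∈ L₃` for all `w`, `w'`. -/
def lcsCon (c : A) : RingCon A where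
  r a b := ∀ w w' : A, w * (a - b) * w' * c - c * (w * (a - b) * w') ∈ lcs A 2
  iseqv :=
    { refl := fun a w w' => by simp
      symm := fun {a b} h w w' => by
        convert neg_mem (h w w') using 1
        noncomm_ring
      trans := fun {a b d} h h' w w' => by
        convert add_mem (h w w') (h' w w') using 1
        noncomm_ring }
  add' := fun {a b d e} h h' w w' => by
    convert add_mem (h w w') (h' w w') using 1
    noncomm_ring
  mul' := fun {a b d e} h h' w w' => by
    convert add_mem (h w (d * w')) (h' (w * b) w') using 1
    noncomm_ring

end LowerCentralSeries

/-- The elements of `ℂ⟨x,y⟩` killed by abelianization are killed by every homomorphism under which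
the images of `x` and `y` commute. -/
theorem map_eq_zero_of_abmap_eq_zero {C : Type} [Ring C] [Algebra ℂ C] (f : F2 →ₐ[ℂ] C)
    (hf : Function.Surjective f)
    (hxy : Commute (f (FreeAlgebra.ι ℂ 0)) (f (FreeAlgebra.ι ℂ 1))) {b : F2}
    (hb : abmap b = 0) : f b = 0 := by
  have hgen : ∀ i j : Fin 2, Commute (f (FreeAlgebra.ι ℂ i)) (f (FreeAlgebra.ι ℂ j)) := by
    intro i j
    fin_cases i <;> fin_cases j
    exacts [Commute.refl _, hxy, hxy.symm, Commute.refl _]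
  have hleft : ∀ (i : Fin 2) (d : F2), Commute (f (FreeAlgebra.ι ℂ i)) (f d) := by
    intro i d
    induction d using FreeAlgebra.induction with
    | grade0 r => rw [AlgHom.commutes]; exact Algebra.commute_algebraMap_right _ _
    | grade1 j => exact hgen i j
    | mul a b ha hb => rw [map_mul]; exact ha.mul_right hb
    | add a b ha hb => rw [map_add]; exact ha.add_right hb
  have hall : ∀ d e : F2, Commute (f d) (f e) := by
    intro d e
    induction d using FreeAlgebra.induction with
    | grade0 r => rw [AlgHom.commutes]; exact Algebra.commute_algebraMap_left _ _
    | grade1 j => exact hleft j e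
    | mul a b ha hb => rw [map_mul]; exact ha.mul_left hb
    | add a b ha hb => rw [map_add]; exact ha.add_left hb
  let _ : CommRing C :=
    { (inferInstance : Ring C) with
      mul_comm := fun p q => by
        obtain ⟨d, rfl⟩ := hf p
        obtain ⟨e, rfl⟩ := hf q
        exact hall d e }
  let g : MvPolynomial (Fin 2) ℂ →ₐ[ℂ] C := MvPolynomial.aeval fun i => f (FreeAlgebra.ι ℂ i)
  have hg : g.comp abmap = f := by
    refine FreeAlgebra.hom_ext ?_
    funext i
    simp [g, abmap]
  rw [← hg, AlgHom.comp_apply, hb, map_zero]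

/-- In `B₂(ℂ⟨x,y⟩)`, the class of `[b, z]` for a generator `z` depends only on the
abelianization of `b`. -/
theorem commutator_sub_mem_of_abmap_eq (i : Fin 2) {b b' : F2} (h : abmap b = abmap b') :
    (b * FreeAlgebra.ι ℂ i - FreeAlgebra.ι ℂ i * b)
      - (b' * FreeAlgebra.ι ℂ i - FreeAlgebra.ι ℂ i * b') ∈ lcs F2 2 := by
  set z : F2 := FreeAlgebra.ι ℂ i with hz
  let f : F2 →ₐ[ℂ] (lcsCon z).Quotient :=
    { (lcsCon z).mk' with commutes' := fun _ => rfl }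
  have hf : Function.Surjective f := (lcsCon z).mk'_surjective
  have hiff : ∀ p q : F2, f p = f q ↔ lcsCon z p q := fun p q => (lcsCon z).eq
  have hxy : Commute (f (FreeAlgebra.ι ℂ 0)) (f (FreeAlgebra.ι ℂ 1)) := by
    rw [Commute, SemiconjBy, ← map_mul, ← map_mul, hiff]
    intro w w'
    rw [hz]
    fin_cases i
    · convert neg_mem (commutator_ideal_mem_lcs_two w w' (FreeAlgebra.ι ℂ 1 : F2)
        (FreeAlgebra.ι ℂ 0)) using 1
      simp only [Fin.zero_eta]
      noncomm_ring
    · exact commutator_ideal_mem_lcs_two w w' _ _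
  have h0 : f (b - b') = f 0 := by
    rw [map_zero]
    exact map_eq_zero_of_abmap_eq_zero f hf hxy (by rw [map_sub, h, sub_self])
  convert (hiff _ _).1 h0 1 1 using 1
  noncomm_ring

theorem qmap_self (P : F2) : qmap P P = 0 := by
  rw [← map_zero (qmap P)]
  exact RingQuot.mkAlgHom_rel ℂ ⟨rfl, rfl⟩

/-- If `T ≡ [b', z]` modulo `L₃` for a generator `z`, where `b'` and `c P` have the same
abelianization, then `T` vanishes in `B₂` of the quotient by `P`. -/
theorem qmap_mem_lcs_two {P T b' : F2} (c : F2) (i : Fin 2) (hab : abmap (c * P) = abmap b')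
    (hT : T - (b' * FreeAlgebra.ι ℂ i - FreeAlgebra.ι ℂ i * b') ∈ lcs F2 2) :
    qmap P T ∈ lcs (AlgQ P) 2 := by
  have h := map_mem_lcs (qmap P) 2 (sub_mem hT (commutator_sub_mem_of_abmap_eq i hab))
  simpa [qmap_self] using h

/-- let s, r be coprime positive integers, n ≥ 0, u, v ∈ {0,1},
a_0, …, a_n ∈ ℂ, and set u_k = u + (n−k)r, v_k = v + ks. If P ∈ ℂ⟨x,y⟩ is
quasihomogeneous (for the weights deg x = s, deg y = r) with
Pab = Σ_{k=0}^{n} a_k x^{u_k} y^{v_k}, then in B₂(ℂ⟨x,y⟩/⟨P⟩):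
(1) for i ≥ 0, j ≥ 1: Σ_k (a_k/(j+v_k))·[x^{i+u_k}, y^{j+v_k}] = 0, and
(2) for i ≥ 1, j ≥ 0: Σ_k (a_k/(i+u_k))·[x^{i+u_k}, y^{j+v_k}] = 0;
i.e. the corresponding sums of commutators lie in L₃(ℂ⟨x,y⟩/⟨P⟩). -/
theorem stmt13 (s r : ℕ) (hs : 0 < s) (hr : 0 < r) (hco : Nat.Coprime s r)
    (n : ℕ) (u v : ℕ) (hu : u ≤ 1) (hv : v ≤ 1) (a : ℕ → ℂ) (P : F2)
    (hhom : ∃ d, P ∈ degSub s r d)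
    (hPab : abmap P = ∑ k ∈ Finset.range (n + 1),
      MvPolynomial.C (a k) * MvPolynomial.X 0 ^ (u + (n - k) * r)
        * MvPolynomial.X 1 ^ (v + k * s)) :
    (∀ i j : ℕ, 1 ≤ j →
      (∑ k ∈ Finset.range (n + 1),
        (a k / ((j : ℂ) + ((v + k * s : ℕ) : ℂ))) •
          ((qmap P (FreeAlgebra.ι ℂ 0)) ^ (i + (u + (n - k) * r)) *
              (qmap P (FreeAlgebra.ι ℂ 1)) ^ (j + (v + k * s))
            - (qmap P (FreeAlgebra.ι ℂ 1)) ^ (j + (v + k * s)) *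
              (qmap P (FreeAlgebra.ι ℂ 0)) ^ (i + (u + (n - k) * r))))
        ∈ lcs (AlgQ P) 2) ∧
    (∀ i j : ℕ, 1 ≤ i →
      (∑ k ∈ Finset.range (n + 1),
        (a k / ((i : ℂ) + ((u + (n - k) * r : ℕ) : ℂ))) •
          ((qmap P (FreeAlgebra.ι ℂ 0)) ^ (i + (u + (n - k) * r)) *
              (qmap P (FreeAlgebra.ι ℂ 1)) ^ (j + (v + k * s))
            - (qmap P (FreeAlgebra.ι ℂ 1)) ^ (j + (v + k * s)) *
              (qmap P (FreeAlgebra.ι ℂ 0)) ^ (i + (u + (n - k) * r))))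
        ∈ lcs (AlgQ P) 2) := by
  set x : F2 := FreeAlgebra.ι ℂ 0 with hx
  set y : F2 := FreeAlgebra.ι ℂ 1 with hy
  have habx : abmap x = MvPolynomial.X 0 := by simp [abmap, hx]
  have haby : abmap y = MvPolynomial.X 1 := by simp [abmap, hy]
  refine ⟨fun i j hj => ?_, fun i j hi => ?_⟩
  · obtain ⟨j, rfl⟩ := Nat.exists_eq_add_of_le' hj
    simp only [← map_pow, ← map_mul, ← map_sub, ← map_smul, ← map_sum]
    refine qmap_mem_lcs_two (b' := ∑ k ∈ Finset.range (n + 1),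
      a k • (x ^ (i + (u + (n - k) * r)) * y ^ (j + (v + k * s)))) (x ^ i * y ^ j) 1 ?_ ?_
    · simp only [map_mul, map_pow, map_sum, map_smul, habx, haby, hPab, Finset.mul_sum,
        MvPolynomial.smul_eq_C_mul]
      exact Finset.sum_congr rfl fun k _ => by ring
    · rw [Finset.sum_mul, Finset.mul_sum, ← Finset.sum_sub_distrib, ← Finset.sum_sub_distrib]
      refine Submodule.sum_mem _ fun k _ => ?_
      convert smul_commutator_pow_sub_mem_lcs_two (x ^ (i + (u + (n - k) * r))) y
        (j + (v + k * s)) (a k) using 1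
      have e : j + 1 + (v + k * s) = j + (v + k * s) + 1 := by ring
      rw [smul_mul_assoc, mul_smul_comm, ← smul_sub, e]
      congr 3
      push_cast
      ring
  · obtain ⟨i, rfl⟩ := Nat.exists_eq_add_of_le' hi
    simp only [← map_pow, ← map_mul, ← map_sub, ← map_smul, ← map_sum]
    refine qmap_mem_lcs_two (b' := ∑ k ∈ Finset.range (n + 1),
      (-a k) • (y ^ (j + (v + k * s)) * x ^ (i + (u + (n - k) * r)))) (-(x ^ i * y ^ j)) 0 ?_ ?_
    · simp only [map_neg, map_mul, map_pow, map_sum, map_smul, habx, haby, hPab, Finset.mul_sum,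
        MvPolynomial.smul_eq_C_mul]
      exact Finset.sum_congr rfl fun k _ => by ring
    · rw [Finset.sum_mul, Finset.mul_sum, ← Finset.sum_sub_distrib, ← Finset.sum_sub_distrib]
      refine Submodule.sum_mem _ fun k _ => ?_
      convert smul_commutator_pow_sub_mem_lcs_two (y ^ (j + (v + k * s))) x
        (i + (u + (n - k) * r)) (-a k) using 1
      have e : i + 1 + (u + (n - k) * r) = i + (u + (n - k) * r) + 1 := by ring
      rw [smul_mul_assoc, mul_smul_comm, ← smul_sub, e, neg_div, neg_smul (a k / _), ← smul_neg,
        neg_sub]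
      congr 3
      push_cast
      ring
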